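/- Let E be a finite-dimensional spectral COSEA and a∈S_1(E). Then the commutant {a}' equals the set of all b∈E of the form b=λa⊕λ_1a_1⊕⋯⊕λ_na_n, where {a,a_1,…,a_n} is a context of E containing a and λ,λ_1,…,λ_n∈[0,1]. -/

import Mathlib

set_option linter.unusedVariables false

universe u v

theorem prod_eq' {α β : Type*} {p q : α × β} (h1 : p.1 = q.1) (h2 : p.2 = q.2) : p = q :=
  Prod.ext_iff.mpr ⟨h1, h2⟩

/-- A convex sequential effect algebra (COSEA).  The partial sum `⊕` is modelled by a
total operation `oplus` together with a definedness predicate `perp`; all axioms only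
constrain `oplus` on pairs satisfying `perp`.  The scalar action is modelled by a total
map `smul : ℝ → E → E`, with axioms imposed for scalars in `[0,1]`. -/
structure COSEA (E : Type u) where
  zero : E
  one : E
  perp : E → E → Prop
  oplus : E → E → E
  compl : E → E
  smul : ℝ → E → E
  seq : E → E → E
  -- effect algebra axioms
  perp_comm : ∀ a b, perp a b → perp b a
  oplus_comm : ∀ a b, perp a b → oplus a b = oplus b a
  perp_assoc_right : ∀ a b c, perp a b → perp (oplus a b) c → perp b c
  perp_assoc_left : ∀ a b c, perp a b → perp (oplus a b) c → perp a (oplus b c)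
  oplus_assoc : ∀ a b c, perp a b → perp (oplus a b) c →
    oplus a (oplus b c) = oplus (oplus a b) c
  perp_compl : ∀ a, perp a (compl a)
  oplus_compl : ∀ a, oplus a (compl a) = one
  compl_unique : ∀ a b, perp a b → oplus a b = one → b = compl a
  perp_one : ∀ a, perp a one → a = zero
  -- convexity axioms
  smul_smul : ∀ α β a, 0 ≤ α → α ≤ 1 → 0 ≤ β → β ≤ 1 →
    smul α (smul β a) = smul (α * β) a
  perp_smul_self : ∀ α β a, 0 ≤ α → 0 ≤ β → α + β ≤ 1 → perp (smul α a) (smul β a)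
  add_smul : ∀ α β a, 0 ≤ α → 0 ≤ β → α + β ≤ 1 →
    smul (α + β) a = oplus (smul α a) (smul β a)
  perp_smul : ∀ lam a b, 0 ≤ lam → lam ≤ 1 → perp a b → perp (smul lam a) (smul lam b)
  smul_oplus : ∀ lam a b, 0 ≤ lam → lam ≤ 1 → perp a b →
    smul lam (oplus a b) = oplus (smul lam a) (smul lam b)
  one_smul : ∀ a, smul 1 a = a
  -- sequential product axioms
  seq_perp : ∀ a b c, perp b c → perp (seq a b) (seq a c)
  seq_oplus : ∀ a b c, perp b c → seq a (oplus b c) = oplus (seq a b) (seq a c)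
  one_seq : ∀ a, seq one a = a
  seq_eq_zero_comm : ∀ a b, seq a b = zero → seq b a = seq a b
  comm_compl : ∀ a b, seq a b = seq b a → seq a (compl b) = seq (compl b) a
  comm_assoc : ∀ a b c, seq a b = seq b a → seq a (seq b c) = seq (seq a b) c
  comm_seq : ∀ a b c, seq c a = seq a c → seq c b = seq b c →
    seq c (seq a b) = seq (seq a b) c
  comm_oplus : ∀ a b c, seq c a = seq a c → seq c b = seq b c → perp a b →
    seq c (oplus a b) = seq (oplus a b) c
  smul_seq : ∀ lam a b, 0 ≤ lam → lam ≤ 1 → seq (smul lam a) b = smul lam (seq a b)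
  seq_smul : ∀ lam a b, 0 ≤ lam → lam ≤ 1 → seq a (smul lam b) = smul lam (seq a b)

/-- `SumList C l s` : the orthogonal sum of the list `l` is defined and equals `s`. -/
inductive COSEA.SumList {E : Type u} (C : COSEA E) : List E → E → Prop
  | nil : COSEA.SumList C [] C.zero
  | cons {a : E} {l : List E} {s : E} :
      COSEA.SumList C l s → C.perp a s → COSEA.SumList C (a :: l) (C.oplus a s)

namespace COSEA

variable {E : Type u}

/-- `a ≤ b` in the effect-algebra order. -/
def le (C : COSEA E) (a b : E) : Prop := ∃ c, C.perp a c ∧ C.oplus a c = b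

/-- `a` is sharp: the greatest lower bound of `a` and `a'` is `0`,
i.e. every common lower bound of `a` and `a'` lies below `0`. -/
def IsSharp (C : COSEA E) (a : E) : Prop :=
  ∀ c, C.le c a → C.le c (C.compl a) → C.le c C.zero

/-- `a` is a one-dimensional (atomic) sharp element. -/
def IsOneDim (C : COSEA E) (a : E) : Prop :=
  C.IsSharp a ∧ a ≠ C.zero ∧
    ∀ b, C.le b a → ∃ lam : ℝ, 0 ≤ lam ∧ lam ≤ 1 ∧ b = C.smul lam a

/-- A state on a COSEA. -/
def IsState (C : COSEA E) (ω : E → ℝ) : Prop :=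
  (∀ a, 0 ≤ ω a ∧ ω a ≤ 1) ∧ ω C.one = 1 ∧
    ∀ a b, C.perp a b → ω (C.oplus a b) = ω a + ω b

/-- A context presented as an injective finite enumeration of one-dimensional
elements summing to `1`. -/
def IsContextFun (C : COSEA E) {n : ℕ} (a : Fin n → E) : Prop :=
  Function.Injective a ∧ (∀ i, C.IsOneDim (a i)) ∧ C.SumList (List.ofFn a) C.one

/-- A context as a set of effects. -/
def IsContext (C : COSEA E) (A : Set E) : Prop :=
  ∃ (n : ℕ) (a : Fin n → E), C.IsContextFun a ∧ Set.range a = A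

/-- `E` is finite-dimensional: there is no infinite sequence of one-dimensional
elements all of whose initial partial orthogonal sums are defined. -/
def FinDim (C : COSEA E) : Prop :=
  ¬ ∃ f : ℕ → E, (∀ i, C.IsOneDim (f i)) ∧
      ∀ n : ℕ, ∃ s, C.SumList ((List.range n).map f) s

/-- `E` is state-unique. -/
def StateUnique (C : COSEA E) : Prop :=
  ∀ a, C.IsOneDim a → ∃! ω : E → ℝ, C.IsState ω ∧ ω a = 1

/-- `E` is symmetric : `â(b) = b̂(a)` for all one-dimensional `a, b`. -/
def Symm (C : COSEA E) : Prop :=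
  ∀ a b ω ρ, C.IsOneDim a → C.IsOneDim b → C.IsState ω → C.IsState ρ →
    ω a = 1 → ρ b = 1 → ω b = ρ a

/-- `b = λ₁ a₁ ⊕ ⋯ ⊕ λₙ aₙ` with all `λ i ∈ [0,1]`. -/
def SpanRep (C : COSEA E) {n : ℕ} (a : Fin n → E) (lam : Fin n → ℝ) (b : E) : Prop :=
  (∀ i, 0 ≤ lam i ∧ lam i ≤ 1) ∧
    C.SumList (List.ofFn fun i => C.smul (lam i) (a i)) b

/-- `b ∈ E(A)` : `b` has a representation over the context `A`. -/
def InSpan (C : COSEA E) (A : Set E) (b : E) : Prop :=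
  ∃ (n : ℕ) (a : Fin n → E) (lam : Fin n → ℝ),
    C.IsContextFun a ∧ Set.range a = A ∧ C.SpanRep a lam b

/-- `E` is spectral. -/
def Spectral (C : COSEA E) : Prop :=
  C.StateUnique ∧ ∀ b, ∃ A, C.IsContext A ∧ C.InSpan A b

/-- The commutant of a subset. -/
def commutant (C : COSEA E) (F : Set E) : Set E :=
  {b | ∀ a ∈ F, C.seq b a = C.seq a b}

/-- The center `E' = {b : b ∘ a = a ∘ b for all a}`. -/
def center (C : COSEA E) : Set E := C.commutant Set.univ

/-- `E` is a factor: the center consists of the effects `λ 1`, `λ ∈ [0,1]`. -/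
def IsFactor (C : COSEA E) : Prop :=
  C.center = {b | ∃ lam : ℝ, 0 ≤ lam ∧ lam ≤ 1 ∧ b = C.smul lam C.one}

/-- Sub-COSEA. -/
def IsSubCOSEA (C : COSEA E) (F : Set E) : Prop :=
  C.zero ∈ F ∧ C.one ∈ F ∧ (∀ a ∈ F, C.compl a ∈ F) ∧
    (∀ lam : ℝ, 0 ≤ lam → lam ≤ 1 → ∀ a ∈ F, C.smul lam a ∈ F) ∧
    (∀ a ∈ F, ∀ b ∈ F, C.perp a b → C.oplus a b ∈ F) ∧
    (∀ a ∈ F, ∀ b ∈ F, C.seq a b ∈ F)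

/-- `a` is a minimal sharp element of `F`. -/
def MinSharp (C : COSEA E) (F : Set E) (a : E) : Prop :=
  a ∈ F ∧ C.IsSharp a ∧ a ≠ C.zero ∧
    ∀ b ∈ F, C.IsSharp b → b ≠ C.zero → C.le b a → b = a

/-- COSEA isomorphism. -/
def IsIso {F : Type u} (C : COSEA E) (D : COSEA F) (φ : E → F) : Prop :=
  Function.Bijective φ ∧ φ C.one = D.one ∧
    (∀ a b, C.perp a b ↔ D.perp (φ a) (φ b)) ∧
    (∀ a b, C.perp a b → φ (C.oplus a b) = D.oplus (φ a) (φ b)) ∧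
    (∀ lam : ℝ, 0 ≤ lam → lam ≤ 1 → ∀ a, φ (C.smul lam a) = D.smul lam (φ a)) ∧
    (∀ a b, φ (C.seq a b) = D.seq (φ a) (φ b))

/-- `lam` is an eigenvalue of `b` : `lam = â(b)` for some eigeneffect `a` of `b`. -/
def IsEigenvalue (C : COSEA E) (b : E) (lam : ℝ) : Prop :=
  ∃ (a : E) (ω : E → ℝ), C.IsOneDim a ∧ C.seq a b = C.seq b a ∧
    C.IsState ω ∧ ω a = 1 ∧ lam = ω b

/-- The spectrum of `b`. -/
def spectrum (C : COSEA E) (b : E) : Set ℝ := {lam | C.IsEigenvalue b lam}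

/-- `c = ⌈a⌉` : `c` is the least sharp element dominating `a`. -/
def IsCeil (C : COSEA E) (a c : E) : Prop :=
  C.IsSharp c ∧ C.le a c ∧ ∀ d, C.IsSharp d → C.le a d → C.le c d

/-- `b` is a pseudo-inverse of `a` with scalar `lam` :
`⌈b⌉ = ⌈a⌉`, `‖b‖ = 1` and `a ∘ b = b ∘ a = lam ⌈a⌉`. -/
def IsPseudoInvWith (C : COSEA E) (a b : E) (lam : ℝ) : Prop :=
  (∃ ca, C.IsCeil a ca ∧ C.IsCeil b ca ∧
    C.seq a b = C.smul lam ca ∧ C.seq b a = C.smul lam ca) ∧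
  IsGreatest (C.spectrum b) 1 ∧ 0 ≤ lam ∧ lam ≤ 1

/-- The conditional probability map `γ_a` (zero functionals are sent to `0`). -/
noncomputable def condProb (C : COSEA E) (a : E) (ω : E → ℝ) : E → ℝ :=
  fun c => if ω a = 0 then 0 else ω (C.seq a c) / ω a

/-- Membership in `Ω̂(E) = Ω(E) ∪ {0}`. -/
def InOmegaHat (C : COSEA E) (ω : E → ℝ) : Prop :=
  C.IsState ω ∨ ω = fun _ => 0

/-- Direct sum of two COSEAs, with all operations componentwise. -/
def prod {E F : Type u} (C : COSEA E) (D : COSEA F) : COSEA (E × F) where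
  zero := (C.zero, D.zero)
  one := (C.one, D.one)
  perp a b := C.perp a.1 b.1 ∧ D.perp a.2 b.2
  oplus a b := (C.oplus a.1 b.1, D.oplus a.2 b.2)
  compl a := (C.compl a.1, D.compl a.2)
  smul lam a := (C.smul lam a.1, D.smul lam a.2)
  seq a b := (C.seq a.1 b.1, D.seq a.2 b.2)
  perp_comm := fun a b h => ⟨C.perp_comm _ _ h.1, D.perp_comm _ _ h.2⟩
  oplus_comm := fun a b h => prod_eq' (C.oplus_comm _ _ h.1) (D.oplus_comm _ _ h.2)
  perp_assoc_right := fun a b c h1 h2 =>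
    ⟨C.perp_assoc_right _ _ _ h1.1 h2.1, D.perp_assoc_right _ _ _ h1.2 h2.2⟩
  perp_assoc_left := fun a b c h1 h2 =>
    ⟨C.perp_assoc_left _ _ _ h1.1 h2.1, D.perp_assoc_left _ _ _ h1.2 h2.2⟩
  oplus_assoc := fun a b c h1 h2 =>
    prod_eq' (C.oplus_assoc _ _ _ h1.1 h2.1) (D.oplus_assoc _ _ _ h1.2 h2.2)
  perp_compl := fun a => ⟨C.perp_compl _, D.perp_compl _⟩
  oplus_compl := fun a => prod_eq' (C.oplus_compl _) (D.oplus_compl _)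
  compl_unique := fun a b h he =>
    prod_eq' (C.compl_unique _ _ h.1 (congrArg Prod.fst he))
      (D.compl_unique _ _ h.2 (congrArg Prod.snd he))
  perp_one := fun a h => prod_eq' (C.perp_one _ h.1) (D.perp_one _ h.2)
  smul_smul := fun α β a h1 h2 h3 h4 =>
    prod_eq' (C.smul_smul _ _ _ h1 h2 h3 h4) (D.smul_smul _ _ _ h1 h2 h3 h4)
  perp_smul_self := fun α β a h1 h2 h3 =>
    ⟨C.perp_smul_self _ _ _ h1 h2 h3, D.perp_smul_self _ _ _ h1 h2 h3⟩
  add_smul := fun α β a h1 h2 h3 =>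
    prod_eq' (C.add_smul _ _ _ h1 h2 h3) (D.add_smul _ _ _ h1 h2 h3)
  perp_smul := fun lam a b h1 h2 h =>
    ⟨C.perp_smul _ _ _ h1 h2 h.1, D.perp_smul _ _ _ h1 h2 h.2⟩
  smul_oplus := fun lam a b h1 h2 h =>
    prod_eq' (C.smul_oplus _ _ _ h1 h2 h.1) (D.smul_oplus _ _ _ h1 h2 h.2)
  one_smul := fun a => prod_eq' (C.one_smul _) (D.one_smul _)
  seq_perp := fun a b c h => ⟨C.seq_perp _ _ _ h.1, D.seq_perp _ _ _ h.2⟩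
  seq_oplus := fun a b c h => prod_eq' (C.seq_oplus _ _ _ h.1) (D.seq_oplus _ _ _ h.2)
  one_seq := fun a => prod_eq' (C.one_seq _) (D.one_seq _)
  seq_eq_zero_comm := fun a b h =>
    prod_eq' (C.seq_eq_zero_comm _ _ (congrArg Prod.fst h))
      (D.seq_eq_zero_comm _ _ (congrArg Prod.snd h))
  comm_compl := fun a b h =>
    prod_eq' (C.comm_compl _ _ (congrArg Prod.fst h))
      (D.comm_compl _ _ (congrArg Prod.snd h))
  comm_assoc := fun a b c h =>
    prod_eq' (C.comm_assoc _ _ _ (congrArg Prod.fst h))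
      (D.comm_assoc _ _ _ (congrArg Prod.snd h))
  comm_seq := fun a b c h1 h2 =>
    prod_eq' (C.comm_seq _ _ _ (congrArg Prod.fst h1) (congrArg Prod.fst h2))
      (D.comm_seq _ _ _ (congrArg Prod.snd h1) (congrArg Prod.snd h2))
  comm_oplus := fun a b c h1 h2 hp =>
    prod_eq' (C.comm_oplus _ _ _ (congrArg Prod.fst h1) (congrArg Prod.fst h2) hp.1)
      (D.comm_oplus _ _ _ (congrArg Prod.snd h1) (congrArg Prod.snd h2) hp.2)
  smul_seq := fun lam a b h1 h2 =>
    prod_eq' (C.smul_seq _ _ _ h1 h2) (D.smul_seq _ _ _ h1 h2)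
  seq_smul := fun lam a b h1 h2 =>
    prod_eq' (C.seq_smul _ _ _ h1 h2) (D.seq_smul _ _ _ h1 h2)

/-- Direct sum of a family of COSEAs, with all operations componentwise. -/
def pi {ι : Type v} {E : ι → Type u} (C : ∀ i, COSEA (E i)) : COSEA (∀ i, E i) where
  zero := fun i => (C i).zero
  one := fun i => (C i).one
  perp a b := ∀ i, (C i).perp (a i) (b i)
  oplus a b := fun i => (C i).oplus (a i) (b i)
  compl a := fun i => (C i).compl (a i)
  smul lam a := fun i => (C i).smul lam (a i)
  seq a b := fun i => (C i).seq (a i) (b i)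
  perp_comm := fun a b h i => (C i).perp_comm _ _ (h i)
  oplus_comm := fun a b h => funext fun i => (C i).oplus_comm _ _ (h i)
  perp_assoc_right := fun a b c h1 h2 i => (C i).perp_assoc_right _ _ _ (h1 i) (h2 i)
  perp_assoc_left := fun a b c h1 h2 i => (C i).perp_assoc_left _ _ _ (h1 i) (h2 i)
  oplus_assoc := fun a b c h1 h2 => funext fun i => (C i).oplus_assoc _ _ _ (h1 i) (h2 i)
  perp_compl := fun a i => (C i).perp_compl _
  oplus_compl := fun a => funext fun i => (C i).oplus_compl _
  compl_unique := fun a b h he =>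
    funext fun i => (C i).compl_unique _ _ (h i) (congrFun he i)
  perp_one := fun a h => funext fun i => (C i).perp_one _ (h i)
  smul_smul := fun α β a h1 h2 h3 h4 =>
    funext fun i => (C i).smul_smul _ _ _ h1 h2 h3 h4
  perp_smul_self := fun α β a h1 h2 h3 i => (C i).perp_smul_self _ _ _ h1 h2 h3
  add_smul := fun α β a h1 h2 h3 => funext fun i => (C i).add_smul _ _ _ h1 h2 h3
  perp_smul := fun lam a b h1 h2 h i => (C i).perp_smul _ _ _ h1 h2 (h i)
  smul_oplus := fun lam a b h1 h2 h =>
    funext fun i => (C i).smul_oplus _ _ _ h1 h2 (h i)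
  one_smul := fun a => funext fun i => (C i).one_smul _
  seq_perp := fun a b c h i => (C i).seq_perp _ _ _ (h i)
  seq_oplus := fun a b c h => funext fun i => (C i).seq_oplus _ _ _ (h i)
  one_seq := fun a => funext fun i => (C i).one_seq _
  seq_eq_zero_comm := fun a b h =>
    funext fun i => (C i).seq_eq_zero_comm _ _ (congrFun h i)
  comm_compl := fun a b h => funext fun i => (C i).comm_compl _ _ (congrFun h i)
  comm_assoc := fun a b c h => funext fun i => (C i).comm_assoc _ _ _ (congrFun h i)
  comm_seq := fun a b c h1 h2 =>
    funext fun i => (C i).comm_seq _ _ _ (congrFun h1 i) (congrFun h2 i)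
  comm_oplus := fun a b c h1 h2 hp =>
    funext fun i => (C i).comm_oplus _ _ _ (congrFun h1 i) (congrFun h2 i) (hp i)
  smul_seq := fun lam a b h1 h2 => funext fun i => (C i).smul_seq _ _ _ h1 h2
  seq_smul := fun lam a b h1 h2 => funext fun i => (C i).seq_smul _ _ _ h1 h2

end COSEA

namespace COSEA

variable {E : Type u} (C : COSEA E)

/-! ### Effect algebra basics -/

theorem compl_compl (a : E) : C.compl (C.compl a) = a :=
  (C.compl_unique _ _ (C.perp_comm _ _ (C.perp_compl a))
    ((C.oplus_comm _ _ (C.perp_compl a)).symm.trans (C.oplus_compl a))).symm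

theorem compl_one : C.compl C.one = C.zero :=
  C.perp_one _ (C.perp_comm _ _ (C.perp_compl _))

theorem compl_zero : C.compl C.zero = C.one := by
  rw [← C.compl_one, C.compl_compl]

theorem compl_oplus_self (a : E) : C.oplus (C.compl a) a = C.one :=
  (C.oplus_comm _ _ (C.perp_compl a)).symm.trans (C.oplus_compl a)

theorem one_perp_zero : C.perp C.one C.zero := by
  simpa only [C.compl_one] using C.perp_compl C.one

theorem perp_zero (a : E) : C.perp a C.zero :=
  C.perp_assoc_right (C.compl a) a C.zero (C.perp_comm _ _ (C.perp_compl a))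
    (by rw [C.compl_oplus_self]; exact C.one_perp_zero)

theorem oplus_zero (a : E) : C.oplus a C.zero = a := by
  have hp := C.perp_comm _ _ (C.perp_compl a)
  have h1 : C.perp (C.oplus (C.compl a) a) C.zero := by
    rw [C.compl_oplus_self]; exact C.one_perp_zero
  have h2 := C.oplus_assoc _ _ _ hp h1
  have h3 : C.oplus C.one C.zero = C.one := by
    simpa only [C.compl_one] using C.oplus_compl C.one
  rw [C.compl_oplus_self, h3] at h2
  rw [C.compl_unique _ _ (C.perp_assoc_left _ _ _ hp h1) h2, C.compl_compl]

theorem zero_oplus (a : E) : C.oplus C.zero a = a := by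
  rw [← C.oplus_comm _ _ (C.perp_zero a), C.oplus_zero]

variable {C}

/-- If `a ⊕ b ⊥ c`, then `b` is the complement of `a ⊕ c` whenever `(a ⊕ b) ⊕ c = 1`. -/
theorem eq_compl_of_oplus_oplus {a b c : E} (h : C.perp a b) (hc : C.perp (C.oplus a b) c)
    (h1 : C.oplus (C.oplus a b) c = C.one) : b = C.compl (C.oplus a c) := by
  have hba := C.perp_comm _ _ h
  rw [C.oplus_comm _ _ h] at hc h1
  have hp := C.perp_assoc_left _ _ _ hba hc
  refine C.compl_unique _ _ (C.perp_comm _ _ hp) ?_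
  rw [← C.oplus_comm _ _ hp, C.oplus_assoc _ _ _ hba hc, h1]

theorem oplus_left_cancel {a b c : E} (hb : C.perp a b) (hc : C.perp a c)
    (h : C.oplus a b = C.oplus a c) : b = c := by
  rw [eq_compl_of_oplus_oplus hb (C.perp_compl _) (C.oplus_compl _),
    eq_compl_of_oplus_oplus hc (C.perp_compl _) (C.oplus_compl _), h]

theorem eq_zero_right_of_oplus_eq_zero {a b : E} (h : C.perp a b)
    (h0 : C.oplus a b = C.zero) : b = C.zero := by
  refine C.perp_one _ (C.perp_assoc_right a b C.one h ?_)
  rw [h0, ← C.compl_zero]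
  exact C.perp_compl _

theorem eq_zero_left_of_oplus_eq_zero {a b : E} (h : C.perp a b)
    (h0 : C.oplus a b = C.zero) : a = C.zero :=
  eq_zero_right_of_oplus_eq_zero (C.perp_comm _ _ h) ((C.oplus_comm _ _ h).symm.trans h0)

theorem le_oplus_left {a b : E} (h : C.perp a b) : C.le a (C.oplus a b) := ⟨b, h, rfl⟩

theorem le_oplus_right {a b : E} (h : C.perp a b) : C.le b (C.oplus a b) :=
  ⟨a, C.perp_comm _ _ h, (C.oplus_comm _ _ h).symm⟩

theorem le_refl (a : E) : C.le a a := ⟨C.zero, C.perp_zero a, C.oplus_zero a⟩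

theorem le_trans {a b c : E} (hab : C.le a b) (hbc : C.le b c) : C.le a c := by
  obtain ⟨d, hd, rfl⟩ := hab
  obtain ⟨e, he, rfl⟩ := hbc
  exact ⟨C.oplus d e, C.perp_assoc_left _ _ _ hd he, C.oplus_assoc _ _ _ hd he⟩

theorem le_antisymm {a b : E} (hab : C.le a b) (hba : C.le b a) : a = b := by
  obtain ⟨c, hc, rfl⟩ := hab
  obtain ⟨d, hd, h⟩ := hba
  have hcd : C.oplus c d = C.zero := by
    refine oplus_left_cancel (C.perp_assoc_left _ _ _ hc hd) (C.perp_zero a) ?_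
    rw [C.oplus_assoc _ _ _ hc hd, h, C.oplus_zero]
  rw [eq_zero_left_of_oplus_eq_zero (C.perp_assoc_right _ _ _ hc hd) hcd, C.oplus_zero]

theorem eq_zero_of_le_zero {a : E} (h : C.le a C.zero) : a = C.zero := by
  obtain ⟨c, hc, h0⟩ := h
  exact eq_zero_left_of_oplus_eq_zero hc h0

theorem perp_of_le_right {a b c : E} (h : C.perp a c) (hbc : C.le b c) : C.perp a b := by
  obtain ⟨e, he, rfl⟩ := hbc
  refine C.perp_comm _ _ (C.perp_assoc_right e b a (C.perp_comm _ _ he) ?_)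
  rw [← C.oplus_comm _ _ he]
  exact C.perp_comm _ _ h

theorem perp_of_le_compl {a b : E} (h : C.le b (C.compl a)) : C.perp a b :=
  perp_of_le_right (C.perp_compl a) h

theorem le_compl_of_perp {a b : E} (h : C.perp a b) : C.le b (C.compl a) := by
  have hc := C.perp_compl (C.oplus a b)
  refine ⟨C.compl (C.oplus a b), C.perp_assoc_right _ _ _ h hc, ?_⟩
  refine C.compl_unique _ _ (C.perp_assoc_left _ _ _ h hc) ?_
  rw [C.oplus_assoc _ _ _ h hc, C.oplus_compl]

theorem oplus_le_oplus_left {a b c : E} (h : C.perp a c) (hbc : C.le b c) :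
    C.le (C.oplus a b) (C.oplus a c) := by
  have hab := perp_of_le_right h hbc
  obtain ⟨e, he, rfl⟩ := hbc
  have hbea : C.perp (C.oplus e b) a := by
    rw [← C.oplus_comm _ _ he]; exact C.perp_comm _ _ h
  have hp := C.perp_assoc_left _ _ _ (C.perp_comm _ _ he) hbea
  refine ⟨e, ?_, ?_⟩
  · rw [C.oplus_comm _ _ hab]; exact C.perp_comm _ _ hp
  · have := C.oplus_assoc _ _ _ (C.perp_comm _ _ he) hbea
    rw [← C.oplus_comm _ _ he, ← C.oplus_comm _ _ h] at this
    rw [← this, C.oplus_comm _ _ hab, C.oplus_comm _ _ hp]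

theorem oplus_le_oplus {a b c d : E} (h : C.perp b d) (hab : C.le a b) (hcd : C.le c d) :
    C.perp a c ∧ C.le (C.oplus a c) (C.oplus b d) := by
  have hbc := perp_of_le_right h hcd
  have hca := perp_of_le_right (C.perp_comm _ _ hbc) hab
  refine ⟨C.perp_comm _ _ hca, le_trans ?_ (oplus_le_oplus_left h hcd)⟩
  rw [← C.oplus_comm _ _ hca, C.oplus_comm _ _ hbc]
  exact oplus_le_oplus_left (C.perp_comm _ _ hbc) hab

/-! ### Scalar multiplication -/

variable (C) in
theorem zero_smul (a : E) : C.smul 0 a = C.zero := by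
  have hp := C.perp_smul_self 0 0 a le_rfl le_rfl (by norm_num)
  have h := C.add_smul 0 0 a le_rfl le_rfl (by norm_num)
  rw [add_zero] at h
  exact oplus_left_cancel hp (C.perp_zero _) (by rw [← h, C.oplus_zero])

theorem smul_le_smul {α β : ℝ} (a : E) (h0 : 0 ≤ α) (h : α ≤ β) (h1 : β ≤ 1) :
    C.le (C.smul α a) (C.smul β a) := by
  have hβ : α + (β - α) ≤ 1 := by linarith
  refine ⟨C.smul (β - α) a, C.perp_smul_self _ _ a h0 (by linarith) hβ, ?_⟩
  rw [← C.add_smul _ _ a h0 (by linarith) hβ, add_sub_cancel]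

theorem smul_le_self {α : ℝ} (a : E) (h0 : 0 ≤ α) (h1 : α ≤ 1) : C.le (C.smul α a) a := by
  simpa only [C.one_smul] using smul_le_smul (C := C) a h0 h1 le_rfl

theorem eq_zero_of_half_pow_smul_eq_zero (a : E) (n : ℕ)
    (h : C.smul ((1 / 2) ^ n) a = C.zero) : a = C.zero := by
  induction n with
  | zero => rwa [pow_zero, C.one_smul] at h
  | succ n ih =>
    have h1 : ((1 / 2 : ℝ)) ^ n ≤ 1 := pow_le_one₀ (by norm_num) (by norm_num)
    have h2 : ((1 / 2 : ℝ)) ^ n = (1 / 2) ^ (n + 1) + (1 / 2) ^ (n + 1) := by ring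
    refine ih ?_
    rw [h2, C.add_smul _ _ a (by positivity) (by positivity) (h2 ▸ h1), h, C.oplus_zero]

theorem eq_zero_of_smul_eq_zero {α : ℝ} {a : E} (h0 : 0 < α) (h1 : α ≤ 1)
    (h : C.smul α a = C.zero) : a = C.zero := by
  obtain ⟨n, hn⟩ := exists_pow_lt_of_lt_one h0 (by norm_num : (1 / 2 : ℝ) < 1)
  refine eq_zero_of_half_pow_smul_eq_zero (C := C) a n (eq_zero_of_le_zero ?_)
  rw [← h]
  exact smul_le_smul a (by positivity) hn.le h1

/-! ### The sequential product -/

variable (C) in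
theorem seq_zero (a : E) : C.seq a C.zero = C.zero := by
  have h := C.seq_oplus a _ _ (C.perp_zero C.zero)
  rw [C.oplus_zero] at h
  exact oplus_left_cancel (C.seq_perp a _ _ (C.perp_zero C.zero)) (C.perp_zero _)
    (by rw [← h, C.oplus_zero])

variable (C) in
theorem zero_seq (a : E) : C.seq C.zero a = C.zero := by
  rw [C.seq_eq_zero_comm a C.zero (C.seq_zero a), C.seq_zero]

variable (C) in
theorem seq_one (a : E) : C.seq a C.one = a := by
  have h := C.comm_compl a C.zero (by rw [C.seq_zero, C.zero_seq])
  rwa [C.compl_zero, C.one_seq] at h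

theorem seq_le_seq (a : E) {b c : E} (h : C.le b c) : C.le (C.seq a b) (C.seq a c) := by
  obtain ⟨e, he, rfl⟩ := h
  exact ⟨C.seq a e, C.seq_perp _ _ _ he, (C.seq_oplus _ _ _ he).symm⟩

variable (C) in
theorem seq_le_left (a b : E) : C.le (C.seq a b) a := by
  have h := seq_le_seq (C := C) a ⟨C.compl b, C.perp_compl b, C.oplus_compl b⟩
  rwa [C.seq_one] at h

theorem seq_eq_zero_of_le {a b c : E} (h : C.le b c) (h0 : C.seq a c = C.zero) :
    C.seq a b = C.zero :=
  eq_zero_of_le_zero (h0 ▸ seq_le_seq a h)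

theorem seq_eq_zero_symm {a b : E} (h : C.seq a b = C.zero) : C.seq b a = C.zero :=
  (C.seq_eq_zero_comm a b h).trans h

theorem seq_eq_zero_of_smul {α : ℝ} {a b : E} (h0 : 0 < α) (h1 : α ≤ 1)
    (h : C.seq a (C.smul α b) = C.zero) : C.seq a b = C.zero :=
  eq_zero_of_smul_eq_zero h0 h1 (by rw [← C.seq_smul _ _ _ h0.le h1, h])

/-- Effects with vanishing sequential product are orthogonal. -/
theorem perp_of_seq_eq_zero {a b : E} (h : C.seq a b = C.zero) : C.perp a b := by
  have hc := C.comm_compl a b (C.seq_eq_zero_comm a b h).symm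
  have h1 := C.seq_oplus a _ _ (C.perp_compl b)
  rw [C.oplus_compl, C.seq_one, h, C.zero_oplus, hc] at h1
  refine C.perp_comm _ _ (perp_of_le_compl ?_)
  rw [h1]
  exact C.seq_le_left _ _

theorem IsSharp.seq_compl {a : E} (h : C.IsSharp a) : C.seq a (C.compl a) = C.zero := by
  refine eq_zero_of_le_zero (h _ (C.seq_le_left _ _) ?_)
  rw [C.comm_compl a a rfl]
  exact C.seq_le_left _ _

theorem IsSharp.seq_eq_zero_of_perp {a b : E} (h : C.IsSharp a) (hp : C.perp a b) :
    C.seq a b = C.zero :=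
  seq_eq_zero_of_le (le_compl_of_perp hp) h.seq_compl

theorem IsOneDim.not_perp_self {a : E} (h : C.IsOneDim a) : ¬ C.perp a a := fun hp => by
  have h1 := C.seq_oplus a _ _ (C.perp_compl a)
  rw [C.oplus_compl, C.seq_one, h.1.seq_compl, h.1.seq_eq_zero_of_perp hp, C.oplus_zero] at h1
  exact h.2.1 h1

/-! ### Orthogonal sums of lists -/

theorem SumList.unique {l : List E} {s t : E} (hs : C.SumList l s) (ht : C.SumList l t) :
    s = t := by
  induction hs generalizing t with
  | nil => cases ht; rfl
  | cons _ _ ih =>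
    cases ht with
    | cons h _ => rw [ih h]

theorem SumList.le_of_mem {l : List E} {s x : E} (hs : C.SumList l s) (hx : x ∈ l) :
    C.le x s := by
  induction hs with
  | nil => simp at hx
  | cons _ hp ih =>
    rcases List.mem_cons.1 hx with rfl | hx
    · exact le_oplus_left hp
    · exact le_trans (ih hx) (le_oplus_right hp)

theorem SumList.of_sublist {l l' : List E} {s : E} (hl : l'.Sublist l) (hs : C.SumList l s) :
    ∃ t, C.SumList l' t ∧ C.le t s := by
  induction hl generalizing s with
  | slnil => exact ⟨s, hs, le_refl s⟩
  | cons a _ ih =>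
    cases hs with
    | cons hs hp =>
      obtain ⟨t, ht, hts⟩ := ih hs
      exact ⟨t, ht, le_trans hts (le_oplus_right hp)⟩
  | cons_cons a _ ih =>
    cases hs with
    | cons hs hp =>
      obtain ⟨t, ht, hts⟩ := ih hs
      exact ⟨_, .cons ht (perp_of_le_right hp hts), oplus_le_oplus_left hp hts⟩

theorem SumList.append {l₁ l₂ : List E} {s t : E} (hs : C.SumList l₁ s) (ht : C.SumList l₂ t)
    (hp : C.perp s t) : C.SumList (l₁ ++ l₂) (C.oplus s t) := by
  induction hs with
  | nil => rwa [C.zero_oplus]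
  | cons _ hpa ih =>
    rw [← C.oplus_assoc _ _ _ hpa hp]
    exact .cons (ih (C.perp_assoc_right _ _ _ hpa hp)) (C.perp_assoc_left _ _ _ hpa hp)

theorem SumList.seq_eq_zero {l : List E} {s d : E} (hs : C.SumList l s)
    (h : ∀ x ∈ l, C.seq d x = C.zero) : C.seq d s = C.zero := by
  induction hs with
  | nil => exact C.seq_zero d
  | cons _ hp ih =>
    rw [C.seq_oplus _ _ _ hp, h _ (by simp), ih fun x hx => h x (by simp [hx]), C.zero_oplus]

theorem SumList.comm {l : List E} {s d : E} (hs : C.SumList l s)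
    (h : ∀ x ∈ l, C.seq d x = C.seq x d) : C.seq d s = C.seq s d := by
  induction hs with
  | nil => rw [C.seq_zero, C.zero_seq]
  | cons _ hp ih => exact C.comm_oplus _ _ _ (h _ (by simp)) (ih fun x hx => h x (by simp [hx])) hp

theorem SumList.nodup {l : List E} {s : E} (hs : C.SumList l s)
    (h : ∀ x ∈ l, C.IsOneDim x) : l.Nodup := by
  induction hs with
  | nil => simp
  | cons hs hp ih =>
    refine List.nodup_cons.2 ⟨fun hm => ?_, ih fun x hx => h x (by simp [hx])⟩
    exact (h _ (by simp)).not_perp_self (perp_of_le_right hp (hs.le_of_mem hm))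

/-! ### Weighted lists of effects -/

theorem SumList.smul_le {P : List (ℝ × E)} {s : E} (hs : C.SumList (P.map Prod.snd) s)
    (hP : ∀ p ∈ P, 0 ≤ p.1 ∧ p.1 ≤ 1) :
    ∃ x, C.SumList (P.map fun p => C.smul p.1 p.2) x ∧ C.le x s := by
  induction P generalizing s with
  | nil => exact ⟨s, hs, le_refl s⟩
  | cons p P ih =>
    cases hs with
    | cons hs hp =>
      obtain ⟨x, hx, hxs⟩ := ih hs fun q hq => hP q (by simp [hq])
      have hp1 := hP p (by simp)
      have := oplus_le_oplus hp (smul_le_self p.2 hp1.1 hp1.2) hxs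
      exact ⟨_, .cons hx this.1, this.2⟩

open Classical in
theorem SumList.filter_weight {P : List (ℝ × E)} {x : E} (hP : ∀ p ∈ P, 0 ≤ p.1)
    (hx : C.SumList (P.map fun p => C.smul p.1 p.2) x) :
    C.SumList ((P.filter fun p => 0 < p.1).map fun p => C.smul p.1 p.2) x := by
  induction P generalizing x with
  | nil => exact hx
  | cons p P ih =>
    cases hx with
    | cons hs hp =>
      have := ih (fun q hq => hP q (by simp [hq])) hs
      by_cases h : 0 < p.1
      · rw [List.filter_cons_of_pos (by simpa using h)]
        exact .cons this hp
      · have h0 : p.1 = 0 := _root_.le_antisymm (not_lt.1 h) (hP p (by simp))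
        rw [List.filter_cons_of_neg (by simpa using h)]
        beta_reduce
        rwa [h0, C.zero_smul, C.zero_oplus]

theorem sumList_zero_smul (l : List E) : C.SumList (l.map (C.smul 0)) C.zero := by
  induction l with
  | nil => exact .nil
  | cons a l ih =>
    have := SumList.cons ih (C.perp_zero (C.smul 0 a))
    rwa [C.oplus_zero, C.zero_smul a, ← C.zero_smul a, ← List.map_cons, C.zero_smul] at this

/-- In a spectral COSEA every effect is a combination, with strictly positive weights, of
orthogonal one-dimensional effects. -/
theorem Spectral.exists_pos_decomposition (hSp : C.Spectral) (x : E) :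
    ∃ (P : List (ℝ × E)) (t : E), (∀ p ∈ P, 0 < p.1 ∧ p.1 ≤ 1 ∧ C.IsOneDim p.2) ∧
      C.SumList (P.map Prod.snd) t ∧ C.SumList (P.map fun p => C.smul p.1 p.2) x := by
  classical
  obtain ⟨-, -, n, f, lam, ⟨-, hone, hsum⟩, -, hlam, hx⟩ := hSp.2 x
  set P : List (ℝ × E) := List.ofFn fun i => (lam i, f i) with hPdef
  have hP : ∀ p ∈ P, 0 ≤ p.1 ∧ p.1 ≤ 1 ∧ C.IsOneDim p.2 := by
    intro p hp
    obtain ⟨i, rfl⟩ := (List.mem_ofFn' _ _).1 hp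
    exact ⟨(hlam i).1, (hlam i).2, hone i⟩
  have h1 : C.SumList (P.map Prod.snd) C.one := by
    rw [hPdef, List.map_ofFn]; exact hsum
  have h2 : C.SumList (P.map fun p => C.smul p.1 p.2) x := by
    rw [hPdef, List.map_ofFn]; exact hx
  obtain ⟨t, ht, -⟩ := h1.of_sublist
    ((List.filter_sublist (p := fun p : ℝ × E => decide (0 < p.1))).map Prod.snd)
  refine ⟨_, t, fun p hp => ?_, ht, h2.filter_weight fun p hp => (hP p hp).1⟩
  rw [List.mem_filter] at hp
  exact ⟨by simpa using hp.2, (hP p hp.1).2⟩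

theorem seq_eq_zero_of_weighted {P : List (ℝ × E)} {t x d : E}
    (hP : ∀ p ∈ P, 0 < p.1 ∧ p.1 ≤ 1) (ht : C.SumList (P.map Prod.snd) t)
    (hx : C.SumList (P.map fun p => C.smul p.1 p.2) x) (h : C.seq d x = C.zero) :
    C.seq d t = C.zero := by
  refine ht.seq_eq_zero fun y hy => ?_
  obtain ⟨p, hp, rfl⟩ := List.mem_map.1 hy
  exact seq_eq_zero_of_smul (hP p hp).1 (hP p hp).2
    (seq_eq_zero_of_le (hx.le_of_mem (List.mem_map_of_mem hp)) h)

/-- In a spectral COSEA an effect `d` with `d' ∘ d = 0` is an orthogonal sum of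
one-dimensional effects. -/
theorem Spectral.exists_sumList_oneDim (hSp : C.Spectral) {d : E}
    (hd : C.seq (C.compl d) d = C.zero) :
    ∃ l : List E, (∀ x ∈ l, C.IsOneDim x) ∧ C.SumList l d := by
  obtain ⟨P, t, hP, ht, hx⟩ := hSp.exists_pos_decomposition d
  have hP' : ∀ p ∈ P, 0 < p.1 ∧ p.1 ≤ 1 := fun p hp => ⟨(hP p hp).1, (hP p hp).2.1⟩
  have htd : C.le t d := by
    have := le_compl_of_perp (perp_of_seq_eq_zero (seq_eq_zero_of_weighted hP' ht hx hd))
    rwa [C.compl_compl] at this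
  obtain ⟨y, hy, hyt⟩ := ht.smul_le fun p hp => ⟨(hP' p hp).1.le, (hP' p hp).2⟩
  rw [← hx.unique hy] at hyt
  refine ⟨P.map Prod.snd, fun z hz => ?_, le_antisymm htd hyt ▸ ht⟩
  obtain ⟨p, hp, rfl⟩ := List.mem_map.1 hz
  exact (hP p hp).2.2

theorem IsContextFun.comm_of_spanRep {n : ℕ} {f : Fin (n + 1) → E} {lam : Fin (n + 1) → ℝ}
    {b : E} (hf : C.IsContextFun f) (hb : C.SpanRep f lam b) :
    C.seq (f 0) b = C.seq b (f 0) := by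
  obtain ⟨-, hone, hsum⟩ := hf
  refine hb.2.comm fun x hx => ?_
  obtain ⟨i, rfl⟩ := (List.mem_ofFn' _ _).1 hx
  rw [C.seq_smul _ _ _ (hb.1 i).1 (hb.1 i).2, C.smul_seq _ _ _ (hb.1 i).1 (hb.1 i).2]
  congr 1
  rw [List.ofFn_succ] at hsum
  induction i using Fin.cases with
  | zero => rfl
  | succ i =>
    generalize C.one = o at hsum
    cases hsum with
    | cons hs hp =>
      have hi := perp_of_le_right hp (hs.le_of_mem ((List.mem_ofFn' _ _).2 ⟨i, rfl⟩))
      exact (C.seq_eq_zero_comm _ _ ((hone 0).1.seq_eq_zero_of_perp hi)).symm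

/-- A weighted list of one-dimensional effects summing to `1`, read as a context together
with a representation over it. -/
theorem exists_isContextFun_spanRep {p : ℝ × E} {P : List (ℝ × E)} {b : E}
    (hP : ∀ q ∈ p :: P, 0 ≤ q.1 ∧ q.1 ≤ 1 ∧ C.IsOneDim q.2)
    (h1 : C.SumList ((p :: P).map Prod.snd) C.one)
    (hb : C.SumList ((p :: P).map fun q => C.smul q.1 q.2) b) :
    ∃ (n : ℕ) (f : Fin (n + 1) → E) (lam : Fin (n + 1) → ℝ),
      f 0 = p.2 ∧ C.IsContextFun f ∧ C.SpanRep f lam b := by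
  have hmap : ∀ {β : Type u} (g : ℝ × E → β),
      List.ofFn (fun i => g ((p :: P).get i)) = (p :: P).map g := fun g => by
    conv_rhs => rw [← List.ofFn_get (p :: P), List.map_ofFn]
    rfl
  have hmem : ∀ i, (p :: P).get i ∈ p :: P := fun i => List.get_mem _ i
  refine ⟨P.length, fun i => ((p :: P).get i).2, fun i => ((p :: P).get i).1, rfl,
    ⟨?_, fun i => (hP _ (hmem i)).2.2, (hmap Prod.snd).symm ▸ h1⟩,
    fun i => ⟨(hP _ (hmem i)).1, (hP _ (hmem i)).2.1⟩,
    (hmap fun q => C.smul q.1 q.2).symm ▸ hb⟩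
  refine List.nodup_ofFn.1 ?_
  have hnd : ((p :: P).map Prod.snd).Nodup := h1.nodup fun x hx => by
    obtain ⟨q, hq, rfl⟩ := List.mem_map.1 hx
    exact (hP q hq).2.2
  rw [← hmap Prod.snd] at hnd
  exact hnd

/-- An effect commuting with a one-dimensional effect `a` is represented over a context
containing `a`. -/
theorem Spectral.exists_context_of_comm (hSp : C.Spectral) {a b : E} (ha : C.IsOneDim a)
    (hab : C.seq a b = C.seq b a) :
    ∃ (n : ℕ) (f : Fin (n + 1) → E) (lam : Fin (n + 1) → ℝ),
      f 0 = a ∧ C.IsContextFun f ∧ C.SpanRep f lam b := by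
  obtain ⟨μ, hμ0, hμ1, hμ⟩ := ha.2.2 _ (C.seq_le_left a b)
  set c := C.seq b (C.compl a) with hc
  have hb : C.oplus (C.smul μ a) c = b := by
    rw [← hμ, hab, hc, ← C.seq_oplus _ _ _ (C.perp_compl a), C.oplus_compl, C.seq_one]
  have hac : C.seq a c = C.zero := by
    refine seq_eq_zero_of_le ?_ ha.1.seq_compl
    rw [hc, C.comm_compl b a hab.symm]
    exact C.seq_le_left _ _
  obtain ⟨P, t, hP, ht, hx⟩ := hSp.exists_pos_decomposition c
  have hat := perp_of_seq_eq_zero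
    (seq_eq_zero_of_weighted (fun p hp => ⟨(hP p hp).1, (hP p hp).2.1⟩) ht hx hac)
  set d := C.compl (C.oplus a t) with hd
  have hpd : C.perp (C.oplus a t) d := C.perp_compl _
  have hsum : C.SumList (a :: P.map Prod.snd) (C.oplus a t) := .cons ht hat
  have hone : ∀ x ∈ a :: P.map Prod.snd, C.IsOneDim x := by
    intro x hx
    rcases List.mem_cons.1 hx with rfl | hx
    · exact ha
    · obtain ⟨p, hp, rfl⟩ := List.mem_map.1 hx
      exact (hP p hp).2.2
  have hds : C.seq d (C.oplus a t) = C.zero := hsum.seq_eq_zero fun x hx =>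
    seq_eq_zero_symm ((hone x hx).1.seq_eq_zero_of_perp
      (C.perp_comm _ _ (perp_of_le_right (C.perp_comm _ _ hpd) (hsum.le_of_mem hx))))
  obtain ⟨l, hl, hld⟩ := hSp.exists_sumList_oneDim (d := d)
    (by rw [hd, C.compl_compl]; exact seq_eq_zero_symm hds)
  refine exists_isContextFun_spanRep (p := (μ, a)) (P := P ++ l.map fun x => (0, x)) ?_ ?_ ?_
  · intro q hq
    simp only [List.mem_cons, List.mem_append, List.mem_map] at hq
    rcases hq with rfl | hq | ⟨x, hx, rfl⟩
    · exact ⟨hμ0, hμ1, ha⟩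
    · exact ⟨(hP q hq).1.le, (hP q hq).2⟩
    · exact ⟨le_rfl, zero_le_one, hl x hx⟩
  · have := hsum.append hld hpd
    rw [hd, C.oplus_compl] at this
    simpa [Function.comp_def] using this
  · have h0 : C.SumList (P.map (fun p => C.smul p.1 p.2) ++ l.map (C.smul 0)) c := by
      have := hx.append (sumList_zero_smul l) (C.perp_zero c)
      rwa [C.oplus_zero] at this
    have hp : C.perp (C.smul μ a) c :=
      C.perp_comm _ _ (perp_of_le_right (C.perp_comm _ _ (perp_of_seq_eq_zero hac))
        (smul_le_self a hμ0 hμ1))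
    have := SumList.cons h0 hp
    rw [hb] at this
    simpa [Function.comp_def] using this

end COSEA

/-- the commutant of a one-dimensional element `a` consists of the
effects `λa ⊕ λ₁a₁ ⊕ ⋯ ⊕ λₙaₙ` for contexts `{a, a₁, …, aₙ}` containing `a`. -/
theorem commutant_of_oneDim {E : Type u} (C : COSEA E)
    (hFD : C.FinDim) (hSp : C.Spectral) (a : E) (ha : C.IsOneDim a) :
    C.commutant {a} =
      {b | ∃ (n : ℕ) (f : Fin (n + 1) → E) (lam : Fin (n + 1) → ℝ),
        f 0 = a ∧ C.IsContextFun f ∧ C.SpanRep f lam b} := by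
  ext b
  constructor
  · intro hb
    exact hSp.exists_context_of_comm ha (hb a rfl).symm
  · rintro ⟨n, f, lam, rfl, hf, hb⟩ x rfl
    exact (hf.comm_of_spanRep hb).symm
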